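/- Let f be a parabolic Monge form with (a_{3,0}, a_{2,1}) ≠ (0,0). Let c = (c₁,c₂) : (−ε,ε) → ℝ² be C^∞ with c(0) = (0,0), c'(0) ≠ (0,0) and P(c(t)) = 0 for all |t| < ε, set L(t) = (c₁(t), c₂(t), f(c(t))), and assume L'(0) × L''(0) ≠ 0 and that the unit binormal of L at 0 satisfies b(0) = ±(0,0,1). If the derivative of the torsion of L satisfies τ'(0) ≠ 0, then f has an A₃ singularity at (0,0). (Equivalently: if f does not have an A₃ singularity at (0,0), then τ'(0) = 0.) -/

import Mathlib

open Real Set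

noncomputable section

/-- Partial derivative in the first variable. -/
def pdu {F : Type*} [NormedAddCommGroup F] [NormedSpace ℝ F] (f : ℝ → ℝ → F) : ℝ → ℝ → F :=
  fun u w => deriv (fun t => f t w) u

/-- Partial derivative in the second variable. -/
def pdw {F : Type*} [NormedAddCommGroup F] [NormedSpace ℝ F] (f : ℝ → ℝ → F) : ℝ → ℝ → F :=
  fun u w => deriv (fun t => f u t) w

/-- Iterated partial derivative `∂_u^i ∂_w^j f`. -/
def pd {F : Type*} [NormedAddCommGroup F] [NormedSpace ℝ F] (i j : ℕ) (f : ℝ → ℝ → F) :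
    ℝ → ℝ → F :=
  pdu^[i] (pdw^[j] f)

/-- The Euclidean inner product on `ℝ³ = ℝ × ℝ × ℝ`. -/
def dot3 (x y : ℝ × ℝ × ℝ) : ℝ := x.1 * y.1 + x.2.1 * y.2.1 + x.2.2 * y.2.2

/-- The cross product on `ℝ³ = ℝ × ℝ × ℝ`. -/
def cross3 (x y : ℝ × ℝ × ℝ) : ℝ × ℝ × ℝ :=
  (x.2.1 * y.2.2 - x.2.2 * y.2.1, x.2.2 * y.1 - x.1 * y.2.2, x.1 * y.2.1 - x.2.1 * y.1)

/-- The Euclidean norm on `ℝ³ = ℝ × ℝ × ℝ`. -/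
def norm3 (x : ℝ × ℝ × ℝ) : ℝ := Real.sqrt (dot3 x x)

/-- The surface parameterization `g(u,w) = (u, p(u,w), q(u,w))`. -/
def gmap (p q : ℝ → ℝ → ℝ) : ℝ → ℝ → ℝ × ℝ × ℝ := fun u w => (u, p u w, q u w)

/-- The height function on the surface parameterized by `g = (u, p, q)` along `v`. -/
def hgt (p q : ℝ → ℝ → ℝ) (v : ℝ × ℝ × ℝ) : ℝ → ℝ → ℝ :=
  fun u w => dot3 (gmap p q u w) v

/-- `g = (u, p(u,w), q(u,w))` is in normal form of order `N`. -/
def NormalFormN (N : ℕ) (p q : ℝ → ℝ → ℝ) (b : ℕ → ℝ) (a : ℕ → ℕ → ℝ) : Prop :=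
  ContDiff ℝ (⊤ : ℕ∞) (fun x : ℝ × ℝ => p x.1 x.2) ∧
  ContDiff ℝ (⊤ : ℕ∞) (fun x : ℝ × ℝ => q x.1 x.2) ∧
  p 0 0 = 0 ∧ q 0 0 = 0 ∧
  pd 1 0 p 0 0 = 0 ∧ pd 0 1 p 0 0 = 0 ∧ pd 1 0 q 0 0 = 0 ∧ pd 0 1 q 0 0 = 0 ∧
  pd 0 2 p 0 0 = 1 ∧
  (∀ i, 2 ≤ i → i ≤ N → pd i 0 p 0 0 = b i) ∧
  (∀ i j, 2 ≤ i + j → i + j ≤ N → 1 ≤ j → ¬(i = 0 ∧ j = 2) → pd i j p 0 0 = 0) ∧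
  (∀ i j, 2 ≤ i + j → i + j ≤ N → pd i j q 0 0 = a i j) ∧
  a 1 1 = 0 ∧ a 0 2 = 0

/-- `h` has an `A_k` singularity at the origin: up to a `C^∞` change of coordinates fixing
the origin, `h` equals `h(0,0) ± x² ± y^(k+1)`. -/
def HasAkSingAt (h : ℝ → ℝ → ℝ) (k : ℕ) : Prop :=
  ∃ (U V : Set (ℝ × ℝ)) (φ ψ : ℝ × ℝ → ℝ × ℝ) (ε₁ ε₂ : ℝ),
    IsOpen U ∧ IsOpen V ∧ ((0, 0) : ℝ × ℝ) ∈ U ∧ ((0, 0) : ℝ × ℝ) ∈ V ∧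
    ContDiffOn ℝ (⊤ : ℕ∞) φ U ∧ ContDiffOn ℝ (⊤ : ℕ∞) ψ V ∧
    Set.MapsTo φ U V ∧ Set.MapsTo ψ V U ∧
    (∀ x ∈ U, ψ (φ x) = x) ∧ (∀ y ∈ V, φ (ψ y) = y) ∧
    φ (0, 0) = (0, 0) ∧ (ε₁ = 1 ∨ ε₁ = -1) ∧ (ε₂ = 1 ∨ ε₂ = -1) ∧
    ∀ x ∈ U, h (φ x).1 (φ x).2 = h 0 0 + ε₁ * x.1 ^ 2 + ε₂ * x.2 ^ (k + 1)

/-- The parabolic-set function `Σ = ⟨g_uu, g_u × g_w⟩⟨g_ww, g_u × g_w⟩ − ⟨g_uw, g_u × g_w⟩²`. -/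
def SigmaFun (p q : ℝ → ℝ → ℝ) : ℝ → ℝ → ℝ := fun u w =>
  dot3 (pd 2 0 (gmap p q) u w) (cross3 (pd 1 0 (gmap p q) u w) (pd 0 1 (gmap p q) u w)) *
      dot3 (pd 0 2 (gmap p q) u w) (cross3 (pd 1 0 (gmap p q) u w) (pd 0 1 (gmap p q) u w)) -
    dot3 (pd 1 1 (gmap p q) u w) (cross3 (pd 1 0 (gmap p q) u w) (pd 0 1 (gmap p q) u w)) ^ 2

/-- The torsion of a space curve `L`. -/
def tor (L : ℝ → ℝ × ℝ × ℝ) : ℝ → ℝ := fun t =>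
  dot3 (cross3 (deriv L t) (deriv (deriv L) t)) (deriv (deriv (deriv L)) t) /
    norm3 (cross3 (deriv L t) (deriv (deriv L) t)) ^ 2

/-- The unit binormal vector of a space curve `L` at `t = 0`. -/
def binormal0 (L : ℝ → ℝ × ℝ × ℝ) : ℝ × ℝ × ℝ :=
  (norm3 (cross3 (deriv L 0) (deriv (deriv L) 0)))⁻¹ • cross3 (deriv L 0) (deriv (deriv L) 0)

/-- `f` is a parabolic Monge form with `∂_w² f(0,0) = k₂ ≠ 0`. -/
def MongeForm (f : ℝ → ℝ → ℝ) (k₂ : ℝ) : Prop :=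
  ContDiff ℝ (⊤ : ℕ∞) (fun x : ℝ × ℝ => f x.1 x.2) ∧ f 0 0 = 0 ∧
  pd 1 0 f 0 0 = 0 ∧ pd 0 1 f 0 0 = 0 ∧
  pd 2 0 f 0 0 = 0 ∧ pd 1 1 f 0 0 = 0 ∧ pd 0 2 f 0 0 = k₂ ∧ k₂ ≠ 0

/-- The parabolic-set function `P = f_uu f_ww − f_uw²` of a Monge form. -/
def Pfun (f : ℝ → ℝ → ℝ) : ℝ → ℝ → ℝ := fun u w =>
  pd 2 0 f u w * pd 0 2 f u w - pd 1 1 f u w ^ 2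

open scoped ContDiff Topology

universe u

/-- Integrating a smooth function over a compact interval preserves smoothness in the
parameter. -/
theorem contDiff_parametric_intervalIntegral {H : Type u} [NormedAddCommGroup H]
    [NormedSpace ℝ H] [ProperSpace H] (n : ℕ) :
    ∀ {E : Type u} [NormedAddCommGroup E] [NormedSpace ℝ E] {F : H × ℝ → E},
      ContDiff ℝ ∞ F → ContDiff ℝ n fun x => ∫ t in (0 : ℝ)..1, F (x, t) := by
  induction n with
  | zero =>
    intro E _ _ F hF
    have hc := hF.continuous
    refine contDiff_zero.2 ?_
    exact intervalIntegral.continuous_parametric_intervalIntegral_of_continuous' (by fun_prop) 0 1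
  | succ n ih =>
    intro E _ _ F hF
    have hF' : ContDiff ℝ ∞ fun p : H × ℝ =>
        (fderiv ℝ F p).comp (ContinuousLinearMap.inl ℝ H ℝ) :=
      (hF.fderiv_right (m := ∞) (by simp)).clm_comp contDiff_const
    have hFc := hF.continuous
    have hFc' := hF'.continuous
    rw [Nat.cast_succ, contDiff_succ_iff_hasFDerivAt]
    refine ⟨fun x => ∫ t in (0 : ℝ)..1,
      (fderiv ℝ F (x, t)).comp (ContinuousLinearMap.inl ℝ H ℝ), ih hF', fun x => ?_⟩
    obtain ⟨C, hC⟩ := ((isCompact_closedBall x 1).prod (isCompact_Icc (a := (0 : ℝ))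
      (b := 1))).exists_bound_of_continuousOn hFc'.continuousOn
    refine intervalIntegral.hasFDerivAt_integral_of_dominated_of_fderiv_le
      (F := fun x t => F (x, t))
      (F' := fun x t => (fderiv ℝ F (x, t)).comp (ContinuousLinearMap.inl ℝ H ℝ))
      (bound := fun _ => C) (Metric.closedBall_mem_nhds x one_pos) ?_ ?_ ?_ ?_ ?_ ?_
    · exact .of_forall fun y =>
        (by fun_prop : Continuous fun t => F (y, t)).aestronglyMeasurable
    · exact (by fun_prop : Continuous fun t => F (x, t)).intervalIntegrable _ _
    · exact (hFc'.comp (by fun_prop : Continuous fun t : ℝ => (x, t))).aestronglyMeasurable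
    · refine .of_forall fun t ht y hy => hC (y, t) ⟨hy, ?_⟩
      rw [Set.uIoc_of_le zero_le_one] at ht
      exact Ioc_subset_Icc_self ht
    · exact intervalIntegrable_const
    · refine .of_forall fun t _ y _ => ?_
      exact ((hF.differentiable (by simp)) (y, t)).hasFDerivAt.comp y
        (hasFDerivAt_prodMk_left y t)

/-- A curried function of two real variables is `C^∞`. -/
def Smooth₂ (h : ℝ → ℝ → ℝ) : Prop := ContDiff ℝ ∞ fun x : ℝ × ℝ => h x.1 x.2

namespace Smooth₂

variable {h : ℝ → ℝ → ℝ}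

theorem comp_prodMk (hh : Smooth₂ h) {x y : ℝ → ℝ} (hx : ContDiff ℝ ∞ x) (hy : ContDiff ℝ ∞ y) :
    ContDiff ℝ ∞ fun t => h (x t) (y t) :=
  ContDiff.comp (g := fun p : ℝ × ℝ => h p.1 p.2) hh (hx.prodMk hy)

theorem hasFDerivAt (hh : Smooth₂ h) (p : ℝ × ℝ) :
    HasFDerivAt (fun x : ℝ × ℝ => h x.1 x.2) (fderiv ℝ (fun x : ℝ × ℝ => h x.1 x.2) p) p :=
  (ContDiff.differentiable hh (by simp) p).hasFDerivAt

theorem pdu_eq_fderiv (hh : Smooth₂ h) (u w : ℝ) :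
    pdu h u w = fderiv ℝ (fun x : ℝ × ℝ => h x.1 x.2) (u, w) (1, 0) :=
  (HasFDerivAt.comp_hasDerivAt (f := fun t => (t, w)) u (hh.hasFDerivAt (u, w))
    ((hasDerivAt_id u).prodMk (hasDerivAt_const u w))).deriv

theorem pdw_eq_fderiv (hh : Smooth₂ h) (u w : ℝ) :
    pdw h u w = fderiv ℝ (fun x : ℝ × ℝ => h x.1 x.2) (u, w) (0, 1) :=
  (HasFDerivAt.comp_hasDerivAt (f := fun t => (u, t)) w (hh.hasFDerivAt (u, w))
    ((hasDerivAt_const w u).prodMk (hasDerivAt_id w))).deriv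

theorem pdu (hh : Smooth₂ h) : Smooth₂ (pdu h) := by
  simp only [Smooth₂, hh.pdu_eq_fderiv]
  exact (ContDiff.fderiv_right (m := ∞) hh (by simp)).clm_apply contDiff_const

theorem pdw (hh : Smooth₂ h) : Smooth₂ (pdw h) := by
  simp only [Smooth₂, hh.pdw_eq_fderiv]
  exact (ContDiff.fderiv_right (m := ∞) hh (by simp)).clm_apply contDiff_const

/-- The chain rule along a plane curve. -/
theorem hasDerivAt_comp (hh : Smooth₂ h) {x y : ℝ → ℝ} {x' y' t : ℝ}
    (hx : HasDerivAt x x' t) (hy : HasDerivAt y y' t) :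
    HasDerivAt (fun s => h (x s) (y s))
      (_root_.pdu h (x t) (y t) * x' + _root_.pdw h (x t) (y t) * y') t := by
  have key : HasDerivAt (fun s => h (x s) (y s)) _ t :=
    HasFDerivAt.comp_hasDerivAt (f := fun s => (x s, y s)) t (hh.hasFDerivAt (x t, y t))
      (hx.prodMk hy)
  have hv : ((x', y') : ℝ × ℝ) = x' • ((1 : ℝ), (0 : ℝ)) + y' • ((0 : ℝ), (1 : ℝ)) := by simp
  rw [hv, map_add, map_smul, map_smul, ← hh.pdu_eq_fderiv, ← hh.pdw_eq_fderiv] at key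
  simpa only [smul_eq_mul, mul_comm] using key

/-- Mixed partial derivatives commute. -/
theorem pdw_pdu (hh : Smooth₂ h) : _root_.pdw (_root_.pdu h) = _root_.pdu (_root_.pdw h) := by
  have hd : Differentiable ℝ (fderiv ℝ fun x : ℝ × ℝ => h x.1 x.2) :=
    (ContDiff.fderiv_right (m := ∞) hh (by simp)).differentiable (by simp)
  funext u w
  rw [hh.pdu.pdw_eq_fderiv, hh.pdw.pdu_eq_fderiv]
  simp only [hh.pdu_eq_fderiv, hh.pdw_eq_fderiv]
  rw [fderiv_clm_apply (hd _) (differentiableAt_const _),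
    fderiv_clm_apply (hd _) (differentiableAt_const _)]
  simpa using second_derivative_symmetric hh.hasFDerivAt (hd (u, w)).hasFDerivAt (0, 1) (1, 0)

/-- Hadamard's lemma in the second variable. -/
theorem exists_eq_add_mul (hh : Smooth₂ h) :
    ∃ K, Smooth₂ K ∧ ∀ u w, h u w = h u 0 + w * K u w := by
  refine ⟨fun u w => ∫ s in (0 : ℝ)..1, _root_.pdw h u (s * w), ?_, fun u w => ?_⟩
  · have hF : ContDiff ℝ ∞ fun p : (ℝ × ℝ) × ℝ => _root_.pdw h p.1.1 (p.2 * p.1.2) :=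
      ContDiff.comp (g := fun p : ℝ × ℝ => _root_.pdw h p.1 p.2)
        (f := fun p : (ℝ × ℝ) × ℝ => (p.1.1, p.2 * p.1.2)) hh.pdw (by fun_prop)
    exact contDiff_infty.2 fun n => contDiff_parametric_intervalIntegral n hF
  · have hd : ∀ s ∈ Set.uIcc (0 : ℝ) 1,
        HasDerivAt (fun s => h u (s * w)) (w * _root_.pdw h u (s * w)) s := fun s _ => by
      simpa [mul_comm] using
        hh.hasDerivAt_comp (hasDerivAt_const s u) ((hasDerivAt_id s).mul_const w)
    have hc : Continuous fun s : ℝ => w * _root_.pdw h u (s * w) :=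
      continuous_const.mul
        (hh.pdw.comp_prodMk contDiff_const (contDiff_id.mul contDiff_const)).continuous
    have := intervalIntegral.integral_eq_sub_of_hasDerivAt hd (hc.intervalIntegrable 0 1)
    rw [intervalIntegral.integral_const_mul] at this
    simp only [one_mul, zero_mul] at this
    rw [this]
    ring

end Smooth₂

theorem iteratedDeriv_succ_of_eq_add_mul {g K : ℝ → ℝ} {a : ℝ} (hK : ContDiff ℝ ∞ K)
    (hg : ∀ t, g t = a + t * K t) (m : ℕ) :
    iteratedDeriv (m + 1) g 0 = (m + 1) * iteratedDeriv m K 0 := by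
  have hd (k : ℕ) (t : ℝ) : HasDerivAt (iteratedDeriv k K) (iteratedDeriv (k + 1) K t) t := by
    rw [iteratedDeriv_succ]
    have hlt : (k : WithTop ℕ∞) < ∞ := by exact_mod_cast ENat.natCast_lt_top k
    exact (hK.differentiable_iteratedDeriv k hlt t).hasDerivAt
  have key : iteratedDeriv (m + 1) g =
      fun t => (m + 1) * iteratedDeriv m K t + t * iteratedDeriv (m + 1) K t := by
    induction m with
    | zero =>
      rw [funext hg, iteratedDeriv_one]
      funext t
      refine (((hasDerivAt_id t).mul (hd 0 t)).const_add a).deriv.trans ?_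
      simp
    | succ m ih =>
      rw [iteratedDeriv_succ, ih]
      funext t
      refine (((hd m t).const_mul _).add ((hasDerivAt_id t).mul (hd (m + 1) t))).deriv.trans ?_
      push_cast
      simp only [id]
      ring
  simp [key]

/-- A smooth function vanishing to order `n` at `0` is `t ^ n` times a smooth function. -/
theorem exists_eq_pow_mul (n : ℕ) : ∀ {g : ℝ → ℝ}, ContDiff ℝ ∞ g →
    (∀ i < n, iteratedDeriv i g 0 = 0) →
    ∃ K : ℝ → ℝ, ContDiff ℝ ∞ K ∧ (∀ t, g t = t ^ n * K t) ∧
      iteratedDeriv n g 0 = n.factorial * K 0 := by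
  induction n with
  | zero => exact fun {g} hg _ => ⟨g, hg, by simp, by simp⟩
  | succ n ih =>
    intro g hg h0
    have hg2 : Smooth₂ fun _ t => g t := hg.comp contDiff_snd
    obtain ⟨K, hK, hgK⟩ := hg2.exists_eq_add_mul
    have hK0 : ContDiff ℝ ∞ (K 0) := hK.comp_prodMk contDiff_const contDiff_id
    have hder := iteratedDeriv_succ_of_eq_add_mul hK0 (hgK 0)
    obtain ⟨K', hK', hKK', hn⟩ := ih hK0 fun i hi => by
      have := h0 (i + 1) (by omega)
      rw [hder] at this
      exact (mul_eq_zero.1 this).resolve_left (by positivity)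
    have hg0 : g 0 = 0 := by simpa using h0 0 n.succ_pos
    refine ⟨K', hK', fun t => ?_, ?_⟩
    · rw [hgK 0 t, hKK', hg0]
      ring
    · rw [hder, hn, Nat.factorial_succ]
      push_cast
      ring

theorem iterate_pdu_eq_iteratedDeriv (h : ℝ → ℝ → ℝ) (i : ℕ) (u w : ℝ) :
    pdu^[i] h u w = iteratedDeriv i (fun t => h t w) u := by
  induction i generalizing u with
  | zero => simp
  | succ i ih =>
    rw [Function.iterate_succ_apply', iteratedDeriv_succ, ← funext ih]
    rfl

theorem iterate_pdw_eq_iteratedDeriv (h : ℝ → ℝ → ℝ) (j : ℕ) (u w : ℝ) :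
    pdw^[j] h u w = iteratedDeriv j (h u) w := by
  induction j generalizing w with
  | zero => simp
  | succ j ih =>
    rw [Function.iterate_succ_apply', iteratedDeriv_succ, ← funext ih]
    rfl

/-- The invertible linear map `(u, w) ↦ (a w, b u)` of the plane. -/
def swapScale {a b : ℝ} (ha : a ≠ 0) (hb : b ≠ 0) : (ℝ × ℝ) ≃L[ℝ] ℝ × ℝ :=
  ContinuousLinearEquiv.equivOfInverse
    ((a • ContinuousLinearMap.snd ℝ ℝ ℝ).prod (b • ContinuousLinearMap.fst ℝ ℝ ℝ))
    ((b⁻¹ • ContinuousLinearMap.snd ℝ ℝ ℝ).prod (a⁻¹ • ContinuousLinearMap.fst ℝ ℝ ℝ))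
    (fun x => by simp [ha, hb]) (fun x => by simp [ha, hb])

/-- A function put in `A_k` form by a smooth map with invertible derivative at the origin has an
`A_k` singularity. -/
theorem hasAkSingAt_of_local_coordinates {h : ℝ → ℝ → ℝ} {k : ℕ} {Ψ : ℝ × ℝ → ℝ × ℝ}
    {O : Set (ℝ × ℝ)} (hO : IsOpen O) (h0 : ((0, 0) : ℝ × ℝ) ∈ O) (hΨ : ContDiffOn ℝ ∞ Ψ O)
    (hΨ0 : Ψ (0, 0) = (0, 0)) {e : (ℝ × ℝ) ≃L[ℝ] ℝ × ℝ}
    (he : HasFDerivAt Ψ (e : (ℝ × ℝ) →L[ℝ] ℝ × ℝ) (0, 0)) {ε₁ ε₂ : ℝ}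
    (h₁ : ε₁ = 1 ∨ ε₁ = -1) (h₂ : ε₂ = 1 ∨ ε₂ = -1)
    (heq : ∀ x ∈ O, h x.1 x.2 = h 0 0 + ε₁ * (Ψ x).1 ^ 2 + ε₂ * (Ψ x).2 ^ (k + 1)) :
    HasAkSingAt h k := by
  have hat : ∀ x ∈ O, ContDiffAt ℝ ∞ Ψ x := fun x hx => hΨ.contDiffAt (hO.mem_nhds hx)
  set O' := O ∩ fderiv ℝ Ψ ⁻¹' Set.range ((↑) : ((ℝ × ℝ) ≃L[ℝ] ℝ × ℝ) → (ℝ × ℝ) →L[ℝ] ℝ × ℝ)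
  have hO' : IsOpen O' := (hΨ.continuousOn_fderiv_of_isOpen hO (by simp)).isOpen_inter_preimage hO
    ContinuousLinearEquiv.isOpen
  have h0' : ((0, 0) : ℝ × ℝ) ∈ O' := ⟨h0, e, he.fderiv.symm⟩
  set Φ := (ContDiffAt.toOpenPartialHomeomorph Ψ (hat _ h0) he (by simp)).restrOpen O' hO'
  have hΦ : ∀ x, Φ x = Ψ x := fun _ => rfl
  have hsource : Φ.source ⊆ O' := fun x hx => hx.2
  have h0s : ((0, 0) : ℝ × ℝ) ∈ Φ.source :=
    ⟨ContDiffAt.mem_toOpenPartialHomeomorph_source (hat _ h0) he (by simp), h0'⟩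
  refine ⟨Φ.target, Φ.source, Φ.symm, Φ, ε₁, ε₂, Φ.open_target, Φ.open_source, ?_, h0s, ?_, ?_,
    fun x hx => Φ.map_target hx, fun x hx => Φ.map_source hx, fun x hx => Φ.right_inv hx,
    fun x hx => Φ.left_inv hx, ?_, h₁, h₂, fun x hx => ?_⟩
  · simpa [hΦ, hΨ0] using Φ.map_source h0s
  · intro x hx
    obtain ⟨hxO, e', he'⟩ := hsource (Φ.map_target hx)
    refine (Φ.contDiffAt_symm hx (f₀' := e') ?_ (hat _ hxO)).contDiffWithinAt
    rw [he']
    exact ((hat _ hxO).differentiableAt (by simp)).hasFDerivAt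
  · exact fun x hx => (hat x (hsource hx).1).contDiffWithinAt
  · simpa [hΦ, hΨ0] using Φ.left_inv h0s
  · have := heq _ (hsource (Φ.map_target hx)).1
    rwa [← hΦ, Φ.right_inv hx] at this

theorem exists_sign_mul_pos {a : ℝ} (ha : a ≠ 0) : ∃ σ : ℝ, (σ = 1 ∨ σ = -1) ∧ 0 < σ * a := by
  rcases ha.lt_or_gt with h | h
  · exact ⟨-1, .inr rfl, by linarith⟩
  · exact ⟨1, .inl rfl, by linarith⟩

/-- Completing the square in `u ^ 4 G + w u ^ 2 B + w ^ 2 H` yields an `A₃` singularity when the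
quasihomogeneous principal part is nondegenerate. -/
theorem hasA3SingAt_of_eq {f : ℝ → ℝ → ℝ} {G B : ℝ → ℝ} {H : ℝ → ℝ → ℝ} (hG : ContDiff ℝ ∞ G)
    (hB : ContDiff ℝ ∞ B) (hH : Smooth₂ H)
    (hf : ∀ u w, f u w = u ^ 4 * G u + w * (u ^ 2 * B u) + w ^ 2 * H u w)
    (hH0 : H 0 0 ≠ 0) (hdisc : 4 * G 0 * H 0 0 ≠ B 0 ^ 2) : HasAkSingAt f 3 := by
  set R : ℝ × ℝ → ℝ := fun x => G x.1 - B x.1 ^ 2 / (4 * H x.1 x.2) with hR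
  have hR0 : R (0, 0) ≠ 0 := by
    simp only [hR]
    intro h
    apply hdisc
    field_simp at h
    linarith
  obtain ⟨σ, hσ, hσ0⟩ := exists_sign_mul_pos hH0
  obtain ⟨ρ, hρ, hρ0⟩ := exists_sign_mul_pos hR0
  have hH' : ContDiff ℝ ∞ fun x : ℝ × ℝ => H x.1 x.2 := hH
  have hG' : ContDiff ℝ ∞ fun x : ℝ × ℝ => G x.1 := hG.comp contDiff_fst
  have hB' : ContDiff ℝ ∞ fun x : ℝ × ℝ => B x.1 := hB.comp contDiff_fst
  set O₁ : Set (ℝ × ℝ) := {x | 0 < σ * H x.1 x.2}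
  have hO₁ : IsOpen O₁ := isOpen_lt continuous_const (continuous_const.mul hH'.continuous)
  have hHne : ∀ x ∈ O₁, H x.1 x.2 ≠ 0 := fun x hx h => by simp [O₁, h] at hx
  have hRO : ContDiffOn ℝ ∞ R O₁ :=
    hG'.contDiffOn.sub ((hB'.pow 2).contDiffOn.div (contDiff_const.mul hH').contDiffOn
      fun x hx => mul_ne_zero four_ne_zero (hHne x hx))
  set O : Set (ℝ × ℝ) := O₁ ∩ (fun x => ρ * R x) ⁻¹' Set.Ioi 0
  have hO : IsOpen O :=
    (continuousOn_const.mul hRO.continuousOn).isOpen_inter_preimage hO₁ isOpen_Ioi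
  have h0O : ((0, 0) : ℝ × ℝ) ∈ O := ⟨hσ0, hρ0⟩
  have hROO : ContDiffOn ℝ ∞ R O := hRO.mono inter_subset_left
  set α : ℝ × ℝ → ℝ := fun x => √(σ * H x.1 x.2) with hα
  set β : ℝ × ℝ → ℝ := fun x => √√(ρ * R x) with hβ
  set m : ℝ × ℝ → ℝ := fun x => x.1 * (B x.1 / (2 * H x.1 x.2)) with hm
  have hαO : ContDiffOn ℝ ∞ α O :=
    (contDiff_const.mul hH').contDiffOn.sqrt fun x hx => hx.1.ne'
  have hβO : ContDiffOn ℝ ∞ β O :=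
    ((contDiffOn_const.mul hROO).sqrt fun x hx => (show 0 < ρ * R x from hx.2).ne').sqrt
      fun x hx => (Real.sqrt_pos.2 hx.2).ne'
  have hmO : ContDiffOn ℝ ∞ m O :=
    contDiff_fst.contDiffOn.mul (hB'.contDiffOn.div (contDiff_const.mul hH').contDiffOn
      fun x hx => mul_ne_zero two_ne_zero (hHne x hx.1))
  have hdiff {g : ℝ × ℝ → ℝ} (hg : ContDiffOn ℝ ∞ g O) :
      HasFDerivAt g (fderiv ℝ g (0, 0)) (0, 0) :=
    ((hg.contDiffAt (hO.mem_nhds h0O)).differentiableAt (by simp)).hasFDerivAt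
  have hα0 : α (0, 0) ≠ 0 := (Real.sqrt_pos.2 hσ0).ne'
  have hβ0 : β (0, 0) ≠ 0 := (Real.sqrt_pos.2 (Real.sqrt_pos.2 hρ0)).ne'
  refine hasAkSingAt_of_local_coordinates (Ψ := fun x => (α x * (x.2 + x.1 * m x), x.1 * β x))
    hO h0O ?_ (by simp) (e := swapScale hα0 hβ0) ?_ hσ hρ ?_
  · exact (hαO.mul (contDiff_snd.contDiffOn.add (contDiff_fst.contDiffOn.mul hmO))).prodMk
      (contDiff_fst.contDiffOn.mul hβO)
  · have hfst : HasFDerivAt (fun x : ℝ × ℝ => x.1) (ContinuousLinearMap.fst ℝ ℝ ℝ) (0, 0) :=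
      hasFDerivAt_fst
    have hsnd : HasFDerivAt (fun x : ℝ × ℝ => x.2) (ContinuousLinearMap.snd ℝ ℝ ℝ) (0, 0) :=
      hasFDerivAt_snd
    refine (((hdiff hαO).mul (hsnd.add (hfst.mul (hdiff hmO)))).prodMk
      (hfst.mul (hdiff hβO))).congr_fderiv ?_
    ext <;> simp [swapScale, hm]
  · intro x hx
    have hne := hHne x hx.1
    have hσ2 : σ * σ = 1 := by rcases hσ with rfl | rfl <;> norm_num
    have hρ2 : ρ * ρ = 1 := by rcases hρ with rfl | rfl <;> norm_num
    have hα2 : α x ^ 2 = σ * H x.1 x.2 := Real.sq_sqrt hx.1.le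
    have hβ4 : β x ^ 4 = ρ * R x := by
      rw [show β x ^ 4 = (β x ^ 2) ^ 2 by ring, hβ]
      simp only
      rw [Real.sq_sqrt (Real.sqrt_nonneg _), Real.sq_sqrt (le_of_lt hx.2)]
    have hf0 : f 0 0 = 0 := by simp [hf]
    simp only [mul_pow, hα2, hβ4]
    rw [hf0, hf, show σ * (σ * H x.1 x.2 * (x.2 + x.1 * m x) ^ 2)
      = (σ * σ) * (H x.1 x.2 * (x.2 + x.1 * m x) ^ 2) by ring,
      show ρ * (x.1 ^ 4 * (ρ * R x)) = (ρ * ρ) * (x.1 ^ 4 * R x) by ring, hσ2, hρ2]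
    simp only [hm, hR]
    field_simp
    ring

/-- The `A₃` criterion for a parabolic Monge form in terms of its Taylor coefficients. -/
theorem MongeForm.hasA3SingAt {f : ℝ → ℝ → ℝ} {k₂ : ℝ} (hM : MongeForm f k₂)
    (h30 : pd 3 0 f 0 0 = 0) (hdisc : k₂ * pd 4 0 f 0 0 ≠ 3 * pd 2 1 f 0 0 ^ 2) :
    HasAkSingAt f 3 := by
  obtain ⟨hf, h00, h10, h01, h20, h11, h02, hk⟩ := hM
  have hf : Smooth₂ f := hf
  obtain ⟨K, hK, hfK⟩ := hf.exists_eq_add_mul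
  obtain ⟨H, hH, hKH⟩ := hK.exists_eq_add_mul
  have hKw (u : ℝ) : pdw f u 0 = K u 0 := by
    have := iteratedDeriv_succ_of_eq_add_mul (hK.comp_prodMk contDiff_const contDiff_id) (hfK u) 0
    simpa [← iterate_pdw_eq_iteratedDeriv] using this
  have hu (i : ℕ) : iteratedDeriv i (fun u => f u 0) 0 = pd i 0 f 0 0 :=
    (iterate_pdu_eq_iteratedDeriv f i 0 0).symm
  have hv (i : ℕ) : iteratedDeriv i (fun u => K u 0) 0 = pd i 1 f 0 0 := by
    simp only [← hKw]
    exact (iterate_pdu_eq_iteratedDeriv (pdw f) i 0 0).symm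
  obtain ⟨G, hG, hfG, hG0⟩ := exists_eq_pow_mul 4 (g := fun u => f u 0)
    (hf.comp_prodMk contDiff_id contDiff_const) fun i hi => by
      interval_cases i
      exacts [h00, (hu 1).trans h10, (hu 2).trans h20, (hu 3).trans h30]
  obtain ⟨B, hB, hfB, hB0⟩ := exists_eq_pow_mul 2 (g := fun u => K u 0)
    (hK.comp_prodMk contDiff_id contDiff_const) fun i hi => by
      interval_cases i
      exacts [(hv 0).trans h01, (hv 1).trans h11]
  rw [hu] at hG0
  rw [hv] at hB0
  have hH0 : k₂ = 2 * H 0 0 := by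
    have e1 := iteratedDeriv_succ_of_eq_add_mul
      (hK.comp_prodMk contDiff_const contDiff_id) (hfK 0) 1
    have e2 := iteratedDeriv_succ_of_eq_add_mul
      (hH.comp_prodMk contDiff_const contDiff_id) (hKH 0) 0
    rw [← iterate_pdw_eq_iteratedDeriv] at e1
    rw [← h02]
    refine e1.trans ?_
    rw [show iteratedDeriv 1 (fun t => K 0 (id t)) 0 = H 0 0 by simpa using e2]
    norm_num
  refine hasA3SingAt_of_eq hG hB hH (fun u w => ?_) (fun h => hk (by simp [hH0, h])) fun h => ?_
  · rw [hfK, hKH, hfG, hfB]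
    ring
  · apply hdisc
    rw [hG0, hB0, hH0]
    norm_num [Nat.factorial]
    linear_combination 12 * h

section Leibniz

variable {g h : ℝ → ℝ}

theorem contDiff_infty_deriv (hg : ContDiff ℝ ∞ g) : ContDiff ℝ ∞ (deriv g) :=
  hg.iterate_deriv 1

theorem hasDerivAt_of_contDiff_infty (hg : ContDiff ℝ ∞ g) (t : ℝ) :
    HasDerivAt g (deriv g t) t :=
  (hg.differentiable (by simp) t).hasDerivAt

theorem deriv_mul_eq (hg : ContDiff ℝ ∞ g) (hh : ContDiff ℝ ∞ h) :
    deriv (fun t => g t * h t) = fun t => deriv g t * h t + g t * deriv h t :=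
  funext fun t =>
    ((hasDerivAt_of_contDiff_infty hg t).mul (hasDerivAt_of_contDiff_infty hh t)).deriv

theorem deriv_add_eq (hg : ContDiff ℝ ∞ g) (hh : ContDiff ℝ ∞ h) :
    deriv (fun t => g t + h t) = fun t => deriv g t + deriv h t :=
  funext fun t =>
    ((hasDerivAt_of_contDiff_infty hg t).add (hasDerivAt_of_contDiff_infty hh t)).deriv

theorem deriv_deriv_mul_eq (hg : ContDiff ℝ ∞ g) (hh : ContDiff ℝ ∞ h) :
    deriv (deriv fun t => g t * h t) = fun t =>
      deriv (deriv g) t * h t + 2 * (deriv g t * deriv h t) + g t * deriv (deriv h) t := by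
  have hg' := contDiff_infty_deriv hg
  have hh' := contDiff_infty_deriv hh
  rw [deriv_mul_eq hg hh, deriv_add_eq (hg'.mul hh) (hg.mul hh'), deriv_mul_eq hg' hh,
    deriv_mul_eq hg hh']
  funext t
  ring

theorem deriv_deriv_deriv_mul_eq (hg : ContDiff ℝ ∞ g) (hh : ContDiff ℝ ∞ h) :
    deriv (deriv (deriv fun t => g t * h t)) = fun t =>
      deriv (deriv (deriv g)) t * h t + 3 * (deriv (deriv g) t * deriv h t) +
        3 * (deriv g t * deriv (deriv h) t) + g t * deriv (deriv (deriv h)) t := by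
  have hg' := contDiff_infty_deriv hg
  have hh' := contDiff_infty_deriv hh
  have hg'' := contDiff_infty_deriv hg'
  have hh'' := contDiff_infty_deriv hh'
  rw [deriv_mul_eq hg hh, deriv_add_eq (hg'.mul hh) (hg.mul hh'),
    deriv_add_eq (contDiff_infty_deriv (hg'.mul hh)) (contDiff_infty_deriv (hg.mul hh')),
    deriv_deriv_mul_eq hg' hh, deriv_deriv_mul_eq hg hh']
  funext t
  ring

end Leibniz

theorem Smooth₂.deriv_comp {h : ℝ → ℝ → ℝ} (hh : Smooth₂ h) {x y : ℝ → ℝ}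
    (hx : ContDiff ℝ ∞ x) (hy : ContDiff ℝ ∞ y) :
    deriv (fun t => h (x t) (y t)) =
      fun t => _root_.pdu h (x t) (y t) * deriv x t + _root_.pdw h (x t) (y t) * deriv y t :=
  funext fun t => (hh.hasDerivAt_comp (hasDerivAt_of_contDiff_infty hx t)
    (hasDerivAt_of_contDiff_infty hy t)).deriv

section ParabolicCurve

variable {f : ℝ → ℝ → ℝ} {k₂ : ℝ} {x y : ℝ → ℝ}

/-- The second derivative of the height of a curve through the origin of a parabolic Monge
form. -/
theorem MongeForm.deriv_deriv_height (hM : MongeForm f k₂) (hx : ContDiff ℝ ∞ x)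
    (hy : ContDiff ℝ ∞ y) (hx0 : x 0 = 0) (hy0 : y 0 = 0) :
    deriv (fun t => f (x t) (y t)) 0 = 0 ∧
      deriv (deriv fun t => f (x t) (y t)) 0 = k₂ * deriv y 0 ^ 2 := by
  obtain ⟨hf, -, h10, h01, h20, h11, h02, -⟩ := hM
  have hf : Smooth₂ f := hf
  have h10 : pdu f 0 0 = 0 := h10
  have h01 : pdw f 0 0 = 0 := h01
  have h20 : pdu (pdu f) 0 0 = 0 := h20
  have h11 : pdu (pdw f) 0 0 = 0 := h11
  have h02 : pdw (pdw f) 0 0 = k₂ := h02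
  have hp := hf.pdu.comp_prodMk hx hy
  have hq := hf.pdw.comp_prodMk hx hy
  have hx' := contDiff_infty_deriv hx
  have hy' := contDiff_infty_deriv hy
  rw [hf.deriv_comp hx hy, deriv_add_eq (hp.mul hx') (hq.mul hy'), deriv_mul_eq hp hx',
    deriv_mul_eq hq hy', hf.pdu.deriv_comp hx hy, hf.pdw.deriv_comp hx hy, hf.pdw_pdu]
  simp only [hx0, hy0, h10, h01, h20, h11, h02]
  exact ⟨by ring, by ring⟩

/-- Along a parabolic curve tangent to the asymptotic direction the cubic coefficient vanishes,
and the first derivative of the height not forced to vanish is the fourth. -/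
theorem MongeForm.height_of_parabolic (hM : MongeForm f k₂) (hx : ContDiff ℝ ∞ x)
    (hy : ContDiff ℝ ∞ y) (hx0 : x 0 = 0) (hy0 : y 0 = 0) (hx1 : deriv x 0 ≠ 0)
    (hy1 : deriv y 0 = 0) (hP : ∀ t, Pfun f (x t) (y t) = 0) :
    pd 3 0 f 0 0 = 0 ∧
      k₂ * (pd 4 0 f 0 0 * deriv x 0 ^ 2 + pd 2 1 f 0 0 * deriv (deriv y) 0) =
        2 * (pd 2 1 f 0 0 * deriv x 0) ^ 2 ∧
      deriv (deriv (deriv fun t => f (x t) (y t))) 0 = 0 ∧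
      deriv (deriv (deriv (deriv fun t => f (x t) (y t)))) 0 =
        pd 4 0 f 0 0 * deriv x 0 ^ 4 + 6 * pd 2 1 f 0 0 * deriv x 0 ^ 2 * deriv (deriv y) 0 +
          3 * k₂ * deriv (deriv y) 0 ^ 2 := by
  obtain ⟨hf, -, h10, h01, h20, h11, h02, hk⟩ := hM
  have hf : Smooth₂ f := hf
  have h10 : pdu f 0 0 = 0 := h10
  have h01 : pdw f 0 0 = 0 := h01
  have h20 : pdu (pdu f) 0 0 = 0 := h20
  have h11 : pdu (pdw f) 0 0 = 0 := h11
  have h02 : pdw (pdw f) 0 0 = k₂ := h02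
  have e30 : pd 3 0 f 0 0 = pdu (pdu (pdu f)) 0 0 := rfl
  have e21 : pd 2 1 f 0 0 = pdu (pdu (pdw f)) 0 0 := rfl
  have e40 : pd 4 0 f 0 0 = pdu (pdu (pdu (pdu f))) 0 0 := rfl
  have hP : ∀ t, pdu (pdu f) (x t) (y t) * pdw (pdw f) (x t) (y t) -
      pdu (pdw f) (x t) (y t) ^ 2 = 0 := hP
  rw [e30, e21, e40]
  have hx' := contDiff_infty_deriv hx
  have hy' := contDiff_infty_deriv hy
  set p : ℝ → ℝ := fun t => pdu f (x t) (y t) with hp_def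
  set q : ℝ → ℝ := fun t => pdw f (x t) (y t) with hq_def
  set A : ℝ → ℝ := fun t => pdu (pdu f) (x t) (y t) with hA_def
  set B : ℝ → ℝ := fun t => pdu (pdw f) (x t) (y t) with hB_def
  set C : ℝ → ℝ := fun t => pdw (pdw f) (x t) (y t) with hC_def
  have hp : ContDiff ℝ ∞ p := hf.pdu.comp_prodMk hx hy
  have hq : ContDiff ℝ ∞ q := hf.pdw.comp_prodMk hx hy
  have hA : ContDiff ℝ ∞ A := hf.pdu.pdu.comp_prodMk hx hy
  have hB : ContDiff ℝ ∞ B := hf.pdw.pdu.comp_prodMk hx hy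
  have hC : ContDiff ℝ ∞ C := hf.pdw.pdw.comp_prodMk hx hy
  have ha := hf.pdu.pdu.pdu.comp_prodMk hx hy
  have hb := hf.pdw.pdu.pdu.comp_prodMk hx hy
  have hp0 : p 0 = 0 := by simp [hp_def, hx0, hy0, h10]
  have hq0 : q 0 = 0 := by simp [hq_def, hx0, hy0, h01]
  have hA0 : A 0 = 0 := by simp [hA_def, hx0, hy0, h20]
  have hB0 : B 0 = 0 := by simp [hB_def, hx0, hy0, h11]
  have hC0 : C 0 = k₂ := by simp [hC_def, hx0, hy0, h02]
  have hz : deriv (fun t => f (x t) (y t)) = fun t => p t * deriv x t + q t * deriv y t :=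
    hf.deriv_comp hx hy
  have hp' : deriv p = fun t => A t * deriv x t + B t * deriv y t := by
    rw [hp_def, hf.pdu.deriv_comp hx hy, hf.pdw_pdu]
  have hq' : deriv q = fun t => B t * deriv x t + C t * deriv y t := hf.pdw.deriv_comp hx hy
  have hA' : deriv A = fun t => pdu (pdu (pdu f)) (x t) (y t) * deriv x t +
      pdu (pdu (pdw f)) (x t) (y t) * deriv y t := by
    rw [hA_def, hf.pdu.pdu.deriv_comp hx hy, hf.pdu.pdw_pdu, hf.pdw_pdu]
  have hB' : deriv B 0 = pdu (pdu (pdw f)) 0 0 * deriv x 0 := by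
    rw [hB_def, hf.pdw.pdu.deriv_comp hx hy]
    simp [hx0, hy0, hy1]
  have hA'' : deriv (deriv A) 0 = pdu (pdu (pdu (pdu f))) 0 0 * deriv x 0 ^ 2 +
      pdu (pdu (pdu f)) 0 0 * deriv (deriv x) 0 +
      pdu (pdu (pdw f)) 0 0 * deriv (deriv y) 0 := by
    rw [hA', deriv_add_eq (ha.mul hx') (hb.mul hy'), deriv_mul_eq ha hx', deriv_mul_eq hb hy',
      hf.pdu.pdu.pdu.deriv_comp hx hy]
    simp only [hx0, hy0, hy1]
    ring
  have hAC : (fun t => A t * C t) = fun t => B t * B t := by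
    funext t
    linear_combination hP t
  have hA1 : deriv A 0 = 0 := by
    have := congrFun (congrArg deriv hAC) 0
    rw [deriv_mul_eq hA hC, deriv_mul_eq hB hB] at this
    simpa [hA0, hB0, hC0, hk] using this
  have h30 : pdu (pdu (pdu f)) 0 0 = 0 := by
    rw [hA'] at hA1
    simpa [hx0, hy0, hy1, hx1] using hA1
  have hA2 : deriv (deriv A) 0 * k₂ = 2 * (deriv B 0 * deriv B 0) := by
    have := congrFun (congrArg (fun F => deriv (deriv F)) hAC) 0
    rw [deriv_deriv_mul_eq hA hC, deriv_deriv_mul_eq hB hB] at this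
    simpa [hA0, hB0, hC0, hA1] using this
  have hp1 : deriv p 0 = 0 := by simp [hp', hA0, hB0]
  have hq1 : deriv q 0 = 0 := by simp [hq', hB0, hy1]
  have hp2 : deriv (deriv p) 0 = 0 := by
    rw [hp', deriv_add_eq (hA.mul hx') (hB.mul hy'), deriv_mul_eq hA hx', deriv_mul_eq hB hy']
    simp [hA0, hB0, hA1, hy1]
  have hq2 : deriv (deriv q) 0 = deriv B 0 * deriv x 0 + k₂ * deriv (deriv y) 0 := by
    rw [hq', deriv_add_eq (hB.mul hx') (hC.mul hy'), deriv_mul_eq hB hx', deriv_mul_eq hC hy']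
    simp [hB0, hC0, hy1]
  have hp3 : deriv (deriv (deriv p)) 0 =
      deriv (deriv A) 0 * deriv x 0 + 2 * (deriv B 0 * deriv (deriv y) 0) := by
    rw [hp', deriv_add_eq (hA.mul hx') (hB.mul hy'),
      deriv_add_eq (contDiff_infty_deriv (hA.mul hx')) (contDiff_infty_deriv (hB.mul hy')),
      deriv_deriv_mul_eq hA hx', deriv_deriv_mul_eq hB hy']
    simp [hA0, hB0, hA1, hy1]
  have hpx := contDiff_infty_deriv (hp.mul hx')
  have hqy := contDiff_infty_deriv (hq.mul hy')
  refine ⟨h30, ?_, ?_, ?_⟩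
  · rw [hA'', hB', h30] at hA2
    linear_combination hA2
  · rw [hz, deriv_add_eq (hp.mul hx') (hq.mul hy'), deriv_add_eq hpx hqy,
      deriv_deriv_mul_eq hp hx', deriv_deriv_mul_eq hq hy']
    simp [hp0, hq0, hp1, hq1, hp2, hy1]
  · rw [hz, deriv_add_eq (hp.mul hx') (hq.mul hy'), deriv_add_eq hpx hqy,
      deriv_add_eq (contDiff_infty_deriv hpx) (contDiff_infty_deriv hqy),
      deriv_deriv_deriv_mul_eq hp hx', deriv_deriv_deriv_mul_eq hq hy']
    simp only [hp0, hq0, hp1, hq1, hp2, hy1, hp3, hq2, hA'', hB', h30]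
    ring

end ParabolicCurve

theorem deriv_prodMk₃ {x y z : ℝ → ℝ} (hx : ContDiff ℝ ∞ x) (hy : ContDiff ℝ ∞ y)
    (hz : ContDiff ℝ ∞ z) :
    deriv (fun t => (x t, y t, z t)) = fun t => (deriv x t, deriv y t, deriv z t) :=
  funext fun t => ((hasDerivAt_of_contDiff_infty hx t).prodMk
    ((hasDerivAt_of_contDiff_infty hy t).prodMk (hasDerivAt_of_contDiff_infty hz t))).deriv

theorem dot3_self_nonneg (v : ℝ × ℝ × ℝ) : 0 ≤ dot3 v v :=
  add_nonneg (add_nonneg (mul_self_nonneg _) (mul_self_nonneg _)) (mul_self_nonneg _)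

theorem dot3_self_ne_zero {v : ℝ × ℝ × ℝ} (hv : v ≠ 0) : dot3 v v ≠ 0 := by
  contrapose! hv
  obtain ⟨a, b, c⟩ := v
  simp only [dot3] at hv
  refine Prod.ext ?_ (Prod.ext ?_ ?_) <;> simp only [Prod.fst_zero, Prod.snd_zero] <;>
    nlinarith [mul_self_nonneg a, mul_self_nonneg b, mul_self_nonneg c]

/-- The torsion of a curve having contact of order at least four with its tangent and osculating
plane `z = 0` is stationary. -/
theorem deriv_tor_eq_zero {x y z : ℝ → ℝ} (hx : ContDiff ℝ ∞ x) (hy : ContDiff ℝ ∞ y)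
    (hz : ContDiff ℝ ∞ z) (hz1 : deriv z 0 = 0) (hz2 : deriv (deriv z) 0 = 0)
    (hz3 : deriv (deriv (deriv z)) 0 = 0) (hz4 : deriv (deriv (deriv (deriv z))) 0 = 0)
    (hreg : cross3 (deriv (fun t => (x t, y t, z t)) 0)
      (deriv (deriv fun t => (x t, y t, z t)) 0) ≠ 0) :
    deriv (tor fun t => (x t, y t, z t)) 0 = 0 := by
  have hx1 := contDiff_infty_deriv hx
  have hy1 := contDiff_infty_deriv hy
  have hz1' := contDiff_infty_deriv hz
  have hx2 := contDiff_infty_deriv hx1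
  have hy2 := contDiff_infty_deriv hy1
  have hz2' := contDiff_infty_deriv hz1'
  have hx3 := contDiff_infty_deriv hx2
  have hy3 := contDiff_infty_deriv hy2
  have hz3' := contDiff_infty_deriv hz2'
  have hD0 := dot3_self_ne_zero hreg
  unfold tor norm3
  simp only [Real.sq_sqrt (dot3_self_nonneg _)]
  rw [deriv_prodMk₃ hx hy hz, deriv_prodMk₃ hx1 hy1 hz1', deriv_prodMk₃ hx2 hy2 hz2'] at *
  have X1 := hasDerivAt_of_contDiff_infty hx1 0
  have Y1 := hasDerivAt_of_contDiff_infty hy1 0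
  have Z1 := hasDerivAt_of_contDiff_infty hz1' 0
  have X2 := hasDerivAt_of_contDiff_infty hx2 0
  have Y2 := hasDerivAt_of_contDiff_infty hy2 0
  have Z2 := hasDerivAt_of_contDiff_infty hz2' 0
  have X3 := hasDerivAt_of_contDiff_infty hx3 0
  have Y3 := hasDerivAt_of_contDiff_infty hy3 0
  have Z3 := hasDerivAt_of_contDiff_infty hz3' 0
  have I := (Y1.mul Z2).sub (Z1.mul Y2)
  have J := (Z1.mul X2).sub (X1.mul Z2)
  have K := (X1.mul Y2).sub (Y1.mul X2)
  have N := ((I.mul X3).add (J.mul Y3)).add (K.mul Z3)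
  have D := ((I.mul I).add (J.mul J)).add (K.mul K)
  refine (N.div D hD0).deriv.trans ?_
  simp [hz1, hz2, hz3, hz4]

/-- Any interval around `0` receives a smooth map from the line that is the identity near `0`. -/
theorem exists_contDiff_retraction {ε : ℝ} (hε : 0 < ε) :
    ∃ θ : ℝ → ℝ, ContDiff ℝ ∞ θ ∧ (∀ t, |θ t| < ε) ∧ ∀ᶠ t in 𝓝 0, θ t = t := by
  let χ : ContDiffBump (0 : ℝ) := ⟨ε / 4, ε / 2, by linarith, by linarith⟩
  refine ⟨fun t => χ t * t, χ.contDiff.mul contDiff_id, fun t => ?_, ?_⟩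
  · rw [abs_mul, abs_of_nonneg χ.nonneg]
    rcases lt_or_ge |t| (ε / 2) with h | h
    · nlinarith [χ.le_one (x := t), χ.nonneg (x := t), abs_nonneg t]
    · rw [χ.zero_of_le_dist (by simpa using h)]
      simpa using hε
  · filter_upwards [χ.eventuallyEq_one] with t ht
    simp [ht]

theorem Filter.EventuallyEq.tor_eq {L M : ℝ → ℝ × ℝ × ℝ} {t : ℝ} (h : L =ᶠ[𝓝 t] M) :
    tor L =ᶠ[𝓝 t] tor M := by
  filter_upwards [h.deriv, h.deriv.deriv, h.deriv.deriv.deriv] with s h1 h2 h3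
  simp only [tor, h1, h2, h3]

/-- The torsion criterion for an `A₃` singularity, for a parabolic curve defined on the whole
line. -/
theorem MongeForm.hasA3SingAt_of_deriv_tor {f : ℝ → ℝ → ℝ} {k₂ : ℝ} (hM : MongeForm f k₂)
    (hpar : ¬(pd 3 0 f 0 0 = 0 ∧ pd 2 1 f 0 0 = 0)) {x y : ℝ → ℝ} (hx : ContDiff ℝ ∞ x)
    (hy : ContDiff ℝ ∞ y) (hx0 : x 0 = 0) (hy0 : y 0 = 0)
    (hP : ∀ t, Pfun f (x t) (y t) = 0)
    (hreg : cross3 (deriv (fun t => (x t, y t, f (x t) (y t))) 0)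
      (deriv (deriv fun t => (x t, y t, f (x t) (y t))) 0) ≠ 0)
    (hbin : binormal0 (fun t => (x t, y t, f (x t) (y t))) = (0, 0, 1) ∨
      binormal0 (fun t => (x t, y t, f (x t) (y t))) = (0, 0, -1))
    (hτ : deriv (tor fun t => (x t, y t, f (x t) (y t))) 0 ≠ 0) : HasAkSingAt f 3 := by
  have hf : Smooth₂ f := hM.1
  have hk : k₂ ≠ 0 := hM.2.2.2.2.2.2.2
  have hz := hf.comp_prodMk hx hy
  obtain ⟨hz1, hz2⟩ := hM.deriv_deriv_height hx hy hx0 hy0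
  have hbin' : (deriv x 0 * deriv (deriv fun t => f (x t) (y t)) 0 = 0 ∧
      deriv y 0 * deriv (deriv fun t => f (x t) (y t)) 0 = 0) ∧
      ¬(deriv x 0 = 0 ∧ deriv y 0 = 0) := by
    simp only [binormal0] at hbin
    rw [deriv_prodMk₃ hx hy hz, deriv_prodMk₃ (contDiff_infty_deriv hx) (contDiff_infty_deriv hy)
      (contDiff_infty_deriv hz)] at hbin
    generalize (norm3 _)⁻¹ = N at hbin
    simp only [cross3, hz1, Prod.smul_mk, Prod.mk.injEq, smul_eq_mul] at hbin
    have hN : N ≠ 0 := by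
      rintro rfl
      rcases hbin with h | h <;> simpa using h.2.2
    obtain ⟨h1, h2, h3⟩ : _ ∧ _ ∧ N * (deriv x 0 * deriv (deriv y) 0 -
        deriv y 0 * deriv (deriv x) 0) ≠ 0 := by
      rcases hbin with ⟨h1, h2, h3⟩ | ⟨h1, h2, h3⟩ <;> exact ⟨h1, h2, by rw [h3]; norm_num⟩
    have h1 := (mul_eq_zero.1 h1).resolve_left hN
    have h2 := (mul_eq_zero.1 h2).resolve_left hN
    refine ⟨⟨by linarith, by linarith⟩, fun ⟨e1, e2⟩ => h3 (by simp [e1, e2])⟩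
  have hz2' : deriv (deriv fun t => f (x t) (y t)) 0 = 0 := by
    by_contra h
    exact hbin'.2 ⟨(mul_eq_zero.1 hbin'.1.1).resolve_right h,
      (mul_eq_zero.1 hbin'.1.2).resolve_right h⟩
  have hy1 : deriv y 0 = 0 := by simpa [hz2, hk] using hz2'
  have hx1 : deriv x 0 ≠ 0 := fun h => hbin'.2 ⟨h, hy1⟩
  obtain ⟨h30, hpara, hz3, hz4⟩ := hM.height_of_parabolic hx hy hx0 hy0 hx1 hy1 hP
  refine hM.hasA3SingAt h30 fun hdisc => hτ (deriv_tor_eq_zero hx hy hz hz1 hz2' hz3 ?_ hreg)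
  have h21 : pd 2 1 f 0 0 ≠ 0 := fun h => hpar ⟨h30, h⟩
  rw [hz4]
  have hy2 : k₂ * deriv (deriv y) 0 = - (pd 2 1 f 0 0 * deriv x 0 ^ 2) := by
    apply mul_left_cancel₀ h21
    linear_combination hpara - deriv x 0 ^ 2 * hdisc
  apply mul_left_cancel₀ hk
  linear_combination deriv x 0 ^ 4 * hdisc +
    (3 * pd 2 1 f 0 0 * deriv x 0 ^ 2 + 3 * k₂ * deriv (deriv y) 0) * hy2

/-- if moreover the unit binormal `b(0)` equals `±(0,0,1)` and `τ'(0) ≠ 0`,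
then `f` has an `A₃` singularity at the origin. -/
theorem monge_A3_of_torsion_deriv (f : ℝ → ℝ → ℝ) (k₂ : ℝ) (hM : MongeForm f k₂)
    (hpar : ¬(pd 3 0 f 0 0 = 0 ∧ pd 2 1 f 0 0 = 0))
    (ε : ℝ) (hε : 0 < ε) (c : ℝ → ℝ × ℝ) (hc : ContDiffOn ℝ (⊤ : ℕ∞) c (Set.Ioo (-ε) ε))
    (hc0 : c 0 = (0, 0)) (hc' : deriv c 0 ≠ (0, 0))
    (hP : ∀ t : ℝ, |t| < ε → Pfun f (c t).1 (c t).2 = 0) :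
    let L : ℝ → ℝ × ℝ × ℝ := fun t => ((c t).1, (c t).2, f (c t).1 (c t).2)
    cross3 (deriv L 0) (deriv (deriv L) 0) ≠ 0 →
      (binormal0 L = (((0 : ℝ), (0 : ℝ), (1 : ℝ)) : ℝ × ℝ × ℝ) ∨
        binormal0 L = (((0 : ℝ), (0 : ℝ), (-1 : ℝ)) : ℝ × ℝ × ℝ)) →
      deriv (tor L) 0 ≠ 0 → HasAkSingAt f 3 := by
  intro L hreg hbin hτ
  obtain ⟨θ, hθ, hθε, hθ0⟩ := exists_contDiff_retraction hε
  have hcθ : ContDiff ℝ ∞ fun t => c (θ t) :=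
    contDiffOn_univ.1 (hc.comp hθ.contDiffOn fun t _ => abs_lt.1 (hθε t))
  have hL : L =ᶠ[𝓝 0] fun t => ((c (θ t)).1, (c (θ t)).2, f (c (θ t)).1 (c (θ t)).2) := by
    filter_upwards [hθ0] with t ht
    simp only [ht, L]
  have hc0' : c (θ 0) = (0, 0) := by rw [hθ0.self_of_nhds, hc0]
  simp only [binormal0] at hbin
  rw [hL.deriv_eq, hL.deriv.deriv_eq] at hreg hbin
  rw [hL.tor_eq.deriv_eq] at hτ
  exact hM.hasA3SingAt_of_deriv_tor hpar (x := fun t => (c (θ t)).1) (y := fun t => (c (θ t)).2)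
    (contDiff_fst.comp hcθ) (contDiff_snd.comp hcθ) (by rw [hc0']) (by rw [hc0'])
    (fun t => hP _ (hθε t)) hreg hbin hτ
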